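/- arXiv:2001.08046 — 3 statements merged into one kernel-verified Lean document; each statement's English description precedes it below -/
import Mathlib

section
/- Let α_1 ≥ α_2 ≥ α_3 ≥ 0 be integers and let ξ_1, ξ_2, ξ_3 ≥ 0 be integers with ξ_1 + ξ_2 + ξ_3 = α_1 + α_2 + α_3, and assume the Kostka number K_{(α_1,α_2,α_3)}(ξ_1,ξ_2,ξ_3) ≥ 1. Then K_{(α_1+2, α_2+1, α_3)}(ξ_1+1, ξ_2+1, ξ_3+1) = K_{(α_1,α_2,α_3)}(ξ_1,ξ_2,ξ_3) + 1. (This is the su(3) identity mult_{λ+ρ}(δ) = mult_λ(δ) + 1 written in partition coordinates, where shifting the highest weight λ by the Weyl vector ρ corresponds to α ↦ α + (2,1,0) and ξ ↦ ξ + (1,1,1).) -/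
/-- `kostka α ξ` is the Kostka number associated to the shape `α` (given by its row
lengths `α 0 ≥ α 1 ≥ …`) and the content `ξ` (for `k ≥ 1`, the entry `k` must occur
exactly `ξ k` times): it counts the fillings `T` of the Young diagram
`{(i, j) | j < α i}` with positive integers that weakly increase along rows and
strictly increase down columns, such that for each `k ≥ 1` the entry `k` occurs
exactly `ξ k` times.  (Fillings are normalized to be `0` outside the diagram.) -/
noncomputable def kostka (α : ℕ → ℕ) (ξ : ℕ → ℕ) : ℕ :=
  Nat.card {T : ℕ × ℕ → ℕ //
    (∀ i j, j + 1 < α i → T (i, j) ≤ T (i, j + 1)) ∧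
    (∀ i j, j < α (i + 1) → T (i, j) < T (i + 1, j)) ∧
    (∀ i j, j < α i → 1 ≤ T (i, j)) ∧
    (∀ i j, α i ≤ j → T (i, j) = 0) ∧
    (∀ k, 1 ≤ k → {c : ℕ × ℕ | c.2 < α c.1 ∧ T c = k}.ncard = ξ k)}

/-- The filling of the shape `(a, b, c)` whose row `0` has entries `≤ 1` in the columns `< t` and
entries `≤ 2` in the columns `< u`, whose row `1` has entries `2` in the columns `< y`, and whose
other entries are `3`. -/
def threeRowFilling (a b c t u y : ℕ) : ℕ × ℕ → ℕ
  | (0, j) => if j < t then 1 else if j < u then 2 else if j < a then 3 else 0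
  | (1, j) => if j < y then 2 else if j < b then 3 else 0
  | (2, j) => if j < c then 3 else 0
  | (_ + 3, _) => 0

theorem exists_threshold_of_le_succ {f : ℕ → ℕ} {n : ℕ}
    (hf : ∀ j, j + 1 < n → f j ≤ f (j + 1)) (k : ℕ) :
    ∃ t ≤ n, ∀ j < n, f j ≤ k ↔ j < t := by
  induction n with
  | zero => exact ⟨0, le_rfl, by simp⟩
  | succ n ih =>
    obtain ⟨t, htn, ht⟩ := ih fun j hj => hf j (by omega)
    by_cases hn : f n ≤ k
    · refine ⟨n + 1, le_rfl, fun j hj => ⟨fun _ => hj, fun _ => ?_⟩⟩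
      have hmono : ∀ d, d ≤ n → f (n - d) ≤ k := by
        intro d
        induction d with
        | zero => simpa using hn
        | succ d ihd =>
          intro hd
          have hstep := hf (n - (d + 1)) (by omega)
          rw [show n - (d + 1) + 1 = n - d by omega] at hstep
          exact hstep.trans (ihd (by omega))
      have := hmono (n - j) (by omega)
      rwa [show n - (n - j) = j by omega] at this
    · refine ⟨t, by omega, fun j hj => ?_⟩
      rcases Nat.lt_succ_iff_lt_or_eq.mp hj with h | rfl
      · exact ht j h
      · exact ⟨fun h => absurd h hn, fun h => by omega⟩

/-- The multiplicities of the entries of `threeRowFilling`. -/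
theorem ncard_threeRowFilling {a b c t u y : ℕ} (htu : t ≤ u) (hua : u ≤ a) (hyb : y ≤ b)
    {k : ℕ} (hk : 1 ≤ k) :
    {x : ℕ × ℕ | x.2 < [a, b, c].getD x.1 0 ∧ threeRowFilling a b c t u y x = k}.ncard
      = [0, t, (u - t) + y, (a - u) + (b - y) + c].getD k 0 := by
  have hset : {x : ℕ × ℕ | x.2 < [a, b, c].getD x.1 0 ∧ threeRowFilling a b c t u y x = k}
      = ((Finset.range 3).sigma fun i => (Finset.range ([a, b, c].getD i 0)).filter
          fun j => threeRowFilling a b c t u y (i, j) = k).map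
            (Equiv.sigmaEquivProd ℕ ℕ).toEmbedding := by
    ext ⟨i, j⟩
    rcases i with _ | _ | _ | i <;> simp
  rw [hset, Set.ncard_coe_finset, Finset.card_map, Finset.card_sigma]
  simp only [Finset.sum_range_succ, Finset.sum_range_zero]
  have hcard : ∀ (n l r : ℕ) (P : ℕ → Prop) [DecidablePred P],
      (∀ j, j < n ∧ P j ↔ l ≤ j ∧ j < r) → ((Finset.range n).filter P).card = r - l := by
    intro n l r P _ h
    rw [← Nat.card_Ico]
    congr 1
    ext j
    simpa using h j
  rcases k with _ | _ | _ | _ | k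
  · omega
  · rw [hcard _ 0 t, hcard _ 0 0, hcard _ 0 0] <;> simp [threeRowFilling] <;> grind
  · rw [hcard _ t u, hcard _ 0 y, hcard _ 0 0] <;> simp [threeRowFilling] <;> grind
  · rw [hcard _ u a, hcard _ y b, hcard _ 0 c] <;> simp [threeRowFilling] <;> grind
  · rw [hcard _ 0 0, hcard _ 0 0, hcard _ 0 0] <;> simp [threeRowFilling] <;> grind

/-- A semistandard filling of a three-row shape with entries at most `3` is a
`threeRowFilling`, and its thresholds satisfy the interlacing inequalities. -/
theorem exists_eq_threeRowFilling {a b c : ℕ} (hba : b ≤ a) (hcb : c ≤ b) {T : ℕ × ℕ → ℕ}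
    (hrow : ∀ i j, j + 1 < [a, b, c].getD i 0 → T (i, j) ≤ T (i, j + 1))
    (hcol : ∀ i j, j < [a, b, c].getD (i + 1) 0 → T (i, j) < T (i + 1, j))
    (hpos : ∀ i j, j < [a, b, c].getD i 0 → 1 ≤ T (i, j))
    (hzero : ∀ i j, [a, b, c].getD i 0 ≤ j → T (i, j) = 0)
    (hle : ∀ i j, T (i, j) ≤ 3) :
    ∃ t u y, T = threeRowFilling a b c t u y ∧ t ≤ u ∧ u ≤ a ∧ b ≤ u ∧ c ≤ y ∧ y ≤ b ∧ y ≤ t := by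
  obtain ⟨t, hta, ht⟩ := exists_threshold_of_le_succ (f := fun j => T (0, j)) (hrow 0) 1
  obtain ⟨u, hua, hu⟩ := exists_threshold_of_le_succ (f := fun j => T (0, j)) (hrow 0) 2
  obtain ⟨y, hyb, hy⟩ := exists_threshold_of_le_succ (f := fun j => T (1, j)) (hrow 1) 2
  have hcol0 : ∀ j < b, T (0, j) < T (1, j) := hcol 0
  have hcol1 : ∀ j < c, T (1, j) < T (2, j) := hcol 1
  have hpos0 : ∀ j < a, 1 ≤ T (0, j) := hpos 0
  have hzero0 : ∀ j, a ≤ j → T (0, j) = 0 := hzero 0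
  have hzero1 : ∀ j, b ≤ j → T (1, j) = 0 := hzero 1
  have hzero2 : ∀ j, c ≤ j → T (2, j) = 0 := hzero 2
  simp only [List.getD_cons_zero, List.getD_cons_succ] at hta ht hua hu hyb hy
  refine ⟨t, u, y, ?_, ?_, hua, ?_, ?_, hyb, ?_⟩
  · funext ⟨i, j⟩
    have h0 := hle 0 j
    have h1 := hle 1 j
    have h2 := hle 2 j
    rcases i with _ | _ | _ | i <;> simp only [threeRowFilling, Nat.zero_add, Nat.reduceAdd]
    · grind
    · grind
    · grind
    · exact hzero _ _ (by simp)
  · by_contra! h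
    have := ht u (by omega)
    have := hu u (by omega)
    omega
  · by_contra! h
    have := hu u (by omega)
    have := hcol0 u h
    have := hle 1 u
    omega
  · by_contra! h
    have := hy y (by omega)
    have := hcol1 y h
    have := hle 2 y
    omega
  · by_contra! h
    have := ht t (by omega)
    have := hy t (by omega)
    have := hcol0 t (by omega)
    omega

/-- A three-row Kostka number counts the possible numbers `y` of entries `2` in the second row. -/
theorem kostka_three_rows {a b c p q r : ℕ} (hba : b ≤ a) (hcb : c ≤ b)
    (hsum : p + q + r = a + b + c) :
    kostka (fun i => [a, b, c].getD i 0) (fun k => [0, p, q, r].getD k 0)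
      = Nat.card {y : ℕ // (c ≤ y ∧ p + q ≤ a + y) ∧
          y ≤ b ∧ y ≤ p ∧ y ≤ q ∧ b + y ≤ p + q} := by
  have hvalid (y : ℕ) (hy : (c ≤ y ∧ p + q ≤ a + y) ∧
      y ≤ b ∧ y ≤ p ∧ y ≤ q ∧ b + y ≤ p + q) (T : ℕ × ℕ → ℕ)
      (hT : T = threeRowFilling a b c p (p + q - y) y) :
      (∀ i j, j + 1 < [a, b, c].getD i 0 → T (i, j) ≤ T (i, j + 1)) ∧
      (∀ i j, j < [a, b, c].getD (i + 1) 0 → T (i, j) < T (i + 1, j)) ∧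
      (∀ i j, j < [a, b, c].getD i 0 → 1 ≤ T (i, j)) ∧
      (∀ i j, [a, b, c].getD i 0 ≤ j → T (i, j) = 0) ∧
      (∀ k, 1 ≤ k →
        {x : ℕ × ℕ | x.2 < [a, b, c].getD x.1 0 ∧ T x = k}.ncard = [0, p, q, r].getD k 0) := by
    subst hT
    refine ⟨fun i j hj => ?_, fun i j hj => ?_, fun i j hj => ?_, fun i j hj => ?_,
      fun k hk => ?_⟩
    on_goal 5 =>
      rw [ncard_threeRowFilling (by omega) (by omega) (by omega) hk,
        show p + q - y - p + y = q by omega, show a - (p + q - y) + (b - y) + c = r by omega]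
    all_goals
      rcases i with _ | _ | _ | i <;> simp [threeRowFilling] at hj ⊢ <;> grind
  refine (Nat.card_congr (Equiv.ofBijective
    (fun y => ⟨threeRowFilling a b c p (p + q - y) y, hvalid y y.2 _ rfl⟩) ⟨?_, ?_⟩)).symm
  · rintro ⟨y, hy⟩ ⟨z, hz⟩ h
    have hT := congrArg Subtype.val h
    have hTy := congrFun hT (1, y)
    have hTz := congrFun hT (1, z)
    simp only [threeRowFilling] at hTy hTz
    ext
    grind
  · rintro ⟨T, hrow, hcol, hpos, hzero, hcount⟩
    dsimp only at hrow hcol hpos hzero hcount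
    have hle : ∀ i j, T (i, j) ≤ 3 := by
      intro i j
      by_contra! h
      have hmem : (i, j) ∈ {x : ℕ × ℕ | x.2 < [a, b, c].getD x.1 0 ∧ T x = T (i, j)} := by
        refine ⟨?_, rfl⟩
        by_contra! hj
        have := hzero i j hj
        omega
      have hfin : {x : ℕ × ℕ | x.2 < [a, b, c].getD x.1 0 ∧ T x = T (i, j)}.Finite := by
        refine ((Finset.range 3 ×ˢ Finset.range a).finite_toSet).subset ?_
        rintro ⟨i₀, j₀⟩ ⟨hx, -⟩
        rcases i₀ with _ | _ | _ | i₀ <;> simp at hx ⊢ <;> omega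
      have hcard := hcount (T (i, j)) (by omega)
      rw [List.getD_eq_default _ _ (by simpa using Nat.succ_le_of_lt h),
        Set.ncard_eq_zero hfin] at hcard
      rw [hcard] at hmem
      exact hmem
    obtain ⟨t, u, y, rfl, htu, hua, hbu, hcy, hyb, hyt⟩ :=
      exists_eq_threeRowFilling hba hcb hrow hcol hpos hzero hle
    have hone := hcount 1 le_rfl
    have htwo := hcount 2 (by omega)
    rw [ncard_threeRowFilling htu hua hyb (by omega)] at hone htwo
    simp only [List.getD_cons_zero, List.getD_cons_succ] at hone htwo
    subst hone
    refine ⟨⟨y, by omega⟩, Subtype.ext ?_⟩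
    dsimp only
    rw [show t + q - y = u by omega]

/-- The `su(3)` identity `mult_{λ+ρ}(δ) = mult_λ(δ) + 1` in partition coordinates:
if `K_{(α₁,α₂,α₃)}(ξ₁,ξ₂,ξ₃) ≥ 1`, then
`K_{(α₁+2, α₂+1, α₃)}(ξ₁+1, ξ₂+1, ξ₃+1) = K_{(α₁,α₂,α₃)}(ξ₁,ξ₂,ξ₃) + 1`. -/
theorem kostka_su3_rho_shift
    (α₁ α₂ α₃ ξ₁ ξ₂ ξ₃ : ℕ) (h12 : α₂ ≤ α₁) (h23 : α₃ ≤ α₂)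
    (hsum : ξ₁ + ξ₂ + ξ₃ = α₁ + α₂ + α₃)
    (hpos : 1 ≤ kostka (fun i => [α₁, α₂, α₃].getD i 0)
      (fun k => [0, ξ₁, ξ₂, ξ₃].getD k 0)) :
    kostka (fun i => [α₁ + 2, α₂ + 1, α₃].getD i 0)
        (fun k => [0, ξ₁ + 1, ξ₂ + 1, ξ₃ + 1].getD k 0)
      = kostka (fun i => [α₁, α₂, α₃].getD i 0)
          (fun k => [0, ξ₁, ξ₂, ξ₃].getD k 0) + 1 := by
  rw [kostka_three_rows h12 h23 hsum] at hpos ⊢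
  rw [kostka_three_rows (by omega) (by omega) (by omega)]
  obtain ⟨y, hy⟩ := (Nat.card_pos_iff.mp hpos).1
  set l := max α₃ (ξ₁ + ξ₂ - α₁)
  set m := min (min α₂ (ξ₁ + ξ₂ - α₂)) (min ξ₁ ξ₂)
  have hcard : ∀ {P : ℕ → Prop} {n : ℕ}, (∀ z, P z ↔ z ∈ Finset.Icc l n) →
      Nat.card {z // P z} = n + 1 - l := by
    intro P n h
    rw [Nat.card_congr (Equiv.subtypeEquivRight h), Nat.card_eq_fintype_card, Fintype.card_coe,
      Nat.card_Icc]
  rw [hcard (n := m + 1) fun z => by rw [Finset.mem_Icc]; omega,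
    hcard (n := m) fun z => by rw [Finset.mem_Icc]; omega]
  omega
end

section
/- For natural numbers k_1, k_2, k_3, let N(k_1,k_2,k_3) denote the number of 6-tuples (a,b,c,d,e,f) of natural numbers satisfying a + d + f = k_1, b + d + e + f = k_2, and c + e + f = k_3. If k_1 ≤ k_3 and k_1 + k_3 ≤ k_2, then N(k_1,k_2,k_3) = (k_1+1)(k_1+2)(3k_3 − k_1 + 3)/6. -/
/-- The Kostant partition function of the root system `A₃`, counting decompositions
`k₁α₁ + k₂α₂ + k₃α₃ = a·α₁ + b·α₂ + c·α₃ + d·(α₁+α₂) + e·(α₂+α₃) + f·(α₁+α₂+α₃)`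
with nonnegative integer coefficients `(a,b,c,d,e,f)`. -/
noncomputable def kostantA3 (k₁ k₂ k₃ : ℕ) : ℕ :=
  Nat.card {t : ℕ × ℕ × ℕ × ℕ × ℕ × ℕ //
    t.1 + t.2.2.2.1 + t.2.2.2.2.2 = k₁ ∧
    t.2.1 + t.2.2.2.1 + t.2.2.2.2.1 + t.2.2.2.2.2 = k₂ ∧
    t.2.2.1 + t.2.2.2.2.1 + t.2.2.2.2.2 = k₃}

/-- When `k₁ + k₃ ≤ k₂` the coefficient of `α₂` is never an obstruction, so a decomposition is
determined by `j = a + d`, `d ≤ j` and `e ≤ m + j`, where `m = k₃ - k₁`. -/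
theorem kostantA3_eq_sum (k₁ k₂ m : ℕ) (h : k₁ + (k₁ + m) ≤ k₂) :
    kostantA3 k₁ k₂ (k₁ + m) = ∑ j ∈ Finset.range (k₁ + 1), (j + 1) * (m + j + 1) := by
  let s : Finset (Σ _ : ℕ, ℕ × ℕ) :=
    (Finset.range (k₁ + 1)).sigma fun j => Finset.range (j + 1) ×ˢ Finset.range (m + j + 1)
  have hs : s.card = ∑ j ∈ Finset.range (k₁ + 1), (j + 1) * (m + j + 1) := by
    simp [s, Finset.card_sigma]
  have mem_s (j d e : ℕ) : ⟨j, d, e⟩ ∈ s ↔ j ≤ k₁ ∧ d ≤ j ∧ e ≤ m + j := by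
    simp [s]
  rw [← hs, ← Fintype.card_coe, ← Nat.card_eq_fintype_card, kostantA3]
  refine Nat.card_congr
    { toFun := fun ⟨(a, _, _, d, e, _), ht⟩ => ⟨⟨a + d, d, e⟩, ?_⟩
      invFun := fun ⟨⟨j, d, e⟩, ht⟩ =>
        ⟨(j - d, k₂ - d - e - (k₁ - j), m + j - e, d, e, k₁ - j), ?_⟩
      left_inv := ?_
      right_inv := ?_ }
  · simp only [mem_s] at ht ⊢
    omega
  · simp only [mem_s] at ht ⊢
    omega
  · rintro ⟨⟨a, b, c, d, e, f⟩, ht⟩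
    simp only [Subtype.mk.injEq, Prod.mk.injEq, true_and] at ht ⊢
    omega
  · rintro ⟨⟨j, d, e⟩, ht⟩
    simp only [mem_s] at ht
    simp only [Subtype.mk.injEq, Sigma.mk.injEq, heq_eq_eq, and_true]
    omega

theorem six_mul_sum_range_succ_mul (k m : ℕ) :
    6 * ∑ j ∈ Finset.range (k + 1), (j + 1) * (m + j + 1) =
      (k + 1) * (k + 2) * (2 * k + 3 * m + 3) := by
  induction k with
  | zero => simp; ring
  | succ k ih =>
    rw [Finset.sum_range_succ, mul_add, ih]
    ring

/-- If `k₁ ≤ k₃` and `k₁ + k₃ ≤ k₂`, then the `A₃` Kostant partition function equals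
`(k₁+1)(k₁+2)(3k₃ − k₁ + 3)/6`. -/
theorem kostant_partition_A3_case3 (k₁ k₂ k₃ : ℕ) (h1 : k₁ ≤ k₃) (h2 : k₁ + k₃ ≤ k₂) :
    6 * kostantA3 k₁ k₂ k₃ = (k₁ + 1) * (k₁ + 2) * (3 * k₃ - k₁ + 3) := by
  obtain ⟨m, rfl⟩ := Nat.exists_eq_add_of_le h1
  rw [kostantA3_eq_sum k₁ k₂ m h2, six_mul_sum_range_succ_mul]
  congr 1
  omega
end

section
/- For natural numbers k_1, k_2, k_3, let N(k_1,k_2,k_3) denote the number of 6-tuples (a,b,c,d,e,f) of natural numbers satisfying a + d + f = k_1, b + d + e + f = k_2, and c + e + f = k_3. If k_1 ≤ k_3 ≤ k_2 ≤ k_1 + k_3, then N(k_1,k_2,k_3) = (k_1+1)(k_1+2)(3k_3 − k_1 + 3)/6 − C(k_1 − k_2 + k_3 + 2, 3), where C(m, 3) denotes the binomial coefficient m choose 3. -/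
open Finset

/-- Parametrise the decompositions by `s = d + f`, then `f`, then `e`. -/
def kostantA3Equiv (k₁ k₂ k₃ : ℕ) (h1 : k₁ ≤ k₃) (h2 : k₃ ≤ k₂) :
    {t : ℕ × ℕ × ℕ × ℕ × ℕ × ℕ //
      t.1 + t.2.2.2.1 + t.2.2.2.2.2 = k₁ ∧
      t.2.1 + t.2.2.2.1 + t.2.2.2.2.1 + t.2.2.2.2.2 = k₂ ∧
      t.2.2.1 + t.2.2.2.2.1 + t.2.2.2.2.2 = k₃} ≃
    ((range (k₁ + 1)).sigma fun s => (range (s + 1)).sigma fun f =>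
      range (min (k₃ - f) (k₂ - s) + 1) : Finset (Σ _ : ℕ, Σ _ : ℕ, ℕ)) where
  toFun t := ⟨⟨t.1.2.2.2.1 + t.1.2.2.2.2.2, t.1.2.2.2.2.2, t.1.2.2.2.2.1⟩, by
    obtain ⟨⟨a, b, c, d, e, f⟩, ht⟩ := t
    simp only [mem_sigma, mem_range] at ht ⊢
    omega⟩
  invFun u := ⟨(k₁ - u.1.1, k₂ - u.1.1 - u.1.2.2, k₃ - u.1.2.2 - u.1.2.1,
      u.1.1 - u.1.2.1, u.1.2.2, u.1.2.1), by
    obtain ⟨⟨s, f, e⟩, hu⟩ := u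
    simp only [mem_sigma, mem_range] at hu ⊢
    omega⟩
  left_inv := by
    rintro ⟨⟨a, b, c, d, e, f⟩, ht⟩
    dsimp only at ht
    simp only [Subtype.mk.injEq, Prod.mk.injEq, and_true]
    omega
  right_inv := by
    rintro ⟨⟨s, f, e⟩, hu⟩
    simp only [mem_sigma, mem_range] at hu
    have hs : s - f + f = s := by omega
    simp only [hs]

theorem kostantA3_eq_sum_s11 (k₁ k₂ k₃ : ℕ) (h1 : k₁ ≤ k₃) (h2 : k₃ ≤ k₂) :
    kostantA3 k₁ k₂ k₃ =
      ∑ s ∈ range (k₁ + 1), ∑ f ∈ range (s + 1), (min (k₃ - f) (k₂ - s) + 1) := by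
  rw [kostantA3, Nat.card_congr (kostantA3Equiv k₁ k₂ k₃ h1 h2), Nat.card_eq_fintype_card,
    Fintype.card_coe]
  simp only [card_sigma, card_range]

theorem sum_range_tsub_eq_choose (m n : ℕ) (h : m ≤ n) :
    ∑ f ∈ range n, (m - f) = (m + 1).choose 2 := by
  induction m generalizing n with
  | zero => simp
  | succ m ih =>
    obtain ⟨n, rfl⟩ : ∃ l, n = l + 1 := ⟨n - 1, by omega⟩
    rw [sum_range_succ', Nat.choose_succ_succ' (m + 1) 1]
    simp only [Nat.add_sub_add_right, ih n (by omega), Nat.choose_one_right, Nat.sub_zero]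
    exact add_comm _ _

theorem sum_range_choose_two_tsub (j n : ℕ) :
    ∑ s ∈ range n, (s + 1 - j).choose 2 = (n + 1 - j).choose 3 := by
  induction n with
  | zero => exact (Nat.choose_eq_zero_of_lt (by omega)).symm
  | succ n ih =>
    rw [sum_range_succ, ih]
    rcases le_or_gt j (n + 1) with h | h
    · rw [Nat.sub_add_comm h, Nat.choose_succ_succ' _ 2, add_comm]
    · rw [Nat.choose_eq_zero_of_lt (by omega), Nat.choose_eq_zero_of_lt (by omega),
        Nat.choose_eq_zero_of_lt (by omega)]

theorem two_mul_sum_range_tsub_add_one (k n : ℕ) (h : n ≤ k + 1) :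
    (2 * (∑ f ∈ range n, (k - f + 1) : ℕ) : ℤ) = n * (2 * k + 3 - n) := by
  induction n with
  | zero => simp
  | succ n ih =>
    have ih := ih (by omega)
    rw [sum_range_succ]
    push_cast [Nat.cast_sub (show n ≤ k by omega)] at ih ⊢
    linear_combination ih

theorem six_mul_sum_range_sum_range_tsub_add_one (k n : ℕ) (h : n ≤ k + 1) :
    (6 * (∑ s ∈ range n, ∑ f ∈ range (s + 1), (k - f + 1) : ℕ) : ℤ)
      = n * (n + 1) * (3 * k - n + 4) := by
  induction n with
  | zero => simp
  | succ n ih =>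
    have ih := ih (by omega)
    have hn := two_mul_sum_range_tsub_add_one k (n + 1) h
    rw [sum_range_succ, Nat.cast_add]
    simp only [Nat.cast_add, Nat.cast_one] at ih hn ⊢
    linear_combination ih + 3 * hn

theorem kostantA3_add_choose (k₁ k₂ k₃ : ℕ) (h1 : k₁ ≤ k₃) (h2 : k₃ ≤ k₂) :
    kostantA3 k₁ k₂ k₃ + (k₁ + 1 + 1 - (k₂ - k₃)).choose 3
      = ∑ s ∈ range (k₁ + 1), ∑ f ∈ range (s + 1), (k₃ - f + 1) := by
  rw [kostantA3_eq_sum_s11 k₁ k₂ k₃ h1 h2, ← sum_range_choose_two_tsub, ← sum_add_distrib]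
  refine sum_congr rfl fun s hs => ?_
  rw [mem_range] at hs
  have hchoose : (s + 1 - (k₂ - k₃)).choose 2 = ∑ f ∈ range (s + 1), (s - (k₂ - k₃) - f) := by
    rw [sum_range_tsub_eq_choose _ _ (by omega)]
    rcases le_or_gt (k₂ - k₃) s with h | h
    · rw [Nat.sub_add_comm h]
    · rw [Nat.choose_eq_zero_of_lt (by omega), Nat.choose_eq_zero_of_lt (by omega)]
  rw [hchoose, ← sum_add_distrib]
  refine sum_congr rfl fun f hf => ?_
  rw [mem_range] at hf
  omega

/-- If `k₁ ≤ k₃ ≤ k₂ ≤ k₁ + k₃`, then the `A₃` Kostant partition function equals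
`(k₁+1)(k₁+2)(3k₃ − k₁ + 3)/6 − C(k₁ − k₂ + k₃ + 2, 3)`. -/
theorem kostant_partition_A3_case4 (k₁ k₂ k₃ : ℕ)
    (h1 : k₁ ≤ k₃) (h2 : k₃ ≤ k₂) (h3 : k₂ ≤ k₁ + k₃) :
    (6 * kostantA3 k₁ k₂ k₃ : ℤ)
      = (k₁ + 1) * (k₁ + 2) * (3 * k₃ - k₁ + 3)
        - 6 * Nat.choose (k₁ + k₃ + 2 - k₂) 3 := by
  have hsum := six_mul_sum_range_sum_range_tsub_add_one k₃ (k₁ + 1) (by omega)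
  rw [← kostantA3_add_choose k₁ k₂ k₃ h1 h2,
    show k₁ + 1 + 1 - (k₂ - k₃) = k₁ + k₃ + 2 - k₂ by omega] at hsum
  simp only [Nat.cast_add, Nat.cast_one] at hsum
  linear_combination hsum
end
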